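/- arXiv:1202.1029 — 2 statements merged into one kernel-verified Lean document; each statement's English description precedes it below -/
import Mathlib

section
/- For all integers p, q, r with min{p+q+1, p−q} ≥ 0, one has 1/π = ((1/2)_{p+q−r+1} · (1/2)_{p−q−r} / (1/2)_r) · ∑_{k=0}^∞ [(3/2)_{k+2p} (3/2)_{k+2q} (−1/2)_{k−2q} (1/2)_{k+r}] / [k! · (k+p+q+1)! · (k+p−q)! · (3/2)_{k+2p−2r}] · (6k+4p+3)/4^{k+r+1}. -/
/-- The shifted factorial `(x)ₙ = Γ(x + n) / Γ(x)` for a real `x` and an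
integer `n` (possibly negative). For a nonnegative integer `n` this equals
`x (x+1) ⋯ (x+n-1)`. -/
noncomputable def shiftedFactorial (x : ℝ) (n : ℤ) : ℝ :=
  Real.Gamma (x + n) / Real.Gamma x

open Filter Topology

/-- The values `Γ(n + 1/2)` of the Gamma function at half-integers. -/
noncomputable def halfGamma (n : ℤ) : ℝ := Real.Gamma ((n : ℝ) + 1 / 2)

theorem int_add_half_ne_zero (n : ℤ) : (n : ℝ) + 1 / 2 ≠ 0 := by
  intro h
  have h2 : ((2 * n + 1 : ℤ) : ℝ) = 0 := by push_cast; linarith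
  have h3 : 2 * n + 1 = 0 := by exact_mod_cast h2
  omega

theorem ne_zero_of_eq_int_add_half {x : ℝ} (n : ℤ) (h : x = n + 1 / 2) : x ≠ 0 :=
  h ▸ int_add_half_ne_zero n

theorem int_add_half_ne_neg_nat (n : ℤ) (m : ℕ) : (n : ℝ) + 1 / 2 ≠ -(m : ℝ) := by
  intro h
  apply int_add_half_ne_zero (n + m)
  push_cast
  linarith

theorem halfGamma_ne_zero (n : ℤ) : halfGamma n ≠ 0 :=
  Real.Gamma_ne_zero (int_add_half_ne_neg_nat n)

theorem halfGamma_add_one (n : ℤ) :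
    halfGamma (n + 1) = ((n : ℝ) + 1 / 2) * halfGamma n := by
  rw [halfGamma, halfGamma, ← Real.Gamma_add_one (int_add_half_ne_zero n)]
  congr 1
  push_cast
  ring

theorem halfGamma_zero : halfGamma 0 = √Real.pi := by
  rw [halfGamma, Int.cast_zero, zero_add, Real.Gamma_one_half_eq]

theorem halfGamma_mul_reflection (n : ℤ) :
    halfGamma (2 * n + 1) * halfGamma (-2 * n - 1) = -Real.pi := by
  have h := Real.Gamma_mul_Gamma_one_sub (((2 * n + 1 : ℤ) : ℝ) + 1 / 2)
  have e : (1 : ℝ) - (((2 * n + 1 : ℤ) : ℝ) + 1 / 2) = ((-2 * n - 1 : ℤ) : ℝ) + 1 / 2 := by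
    push_cast; ring
  rw [e] at h
  rw [halfGamma, halfGamma, h]
  have s : Real.sin (Real.pi * (((2 * n + 1 : ℤ) : ℝ) + 1 / 2)) = -1 := by
    have : Real.pi * (((2 * n + 1 : ℤ) : ℝ) + 1 / 2)
        = (Real.pi / 2 + Real.pi) + n * (2 * Real.pi) := by push_cast; ring
    rw [this, Real.sin_add_int_mul_two_pi, Real.sin_add_pi, Real.sin_pi_div_two]
  rw [s]
  ring

theorem shiftedFactorial_half (n : ℤ) :
    shiftedFactorial (1 / 2) n = halfGamma n / halfGamma 0 := by
  simp only [shiftedFactorial, halfGamma]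
  congr 2
  · ring
  · simp

theorem shiftedFactorial_three_halves (n : ℤ) :
    shiftedFactorial (3 / 2) n = halfGamma (n + 1) / halfGamma 1 := by
  simp only [shiftedFactorial, halfGamma]
  congr 2
  · push_cast; ring
  · norm_num

theorem shiftedFactorial_neg_half (n : ℤ) :
    shiftedFactorial (-(1 / 2)) n = halfGamma (n - 1) / halfGamma (-1) := by
  simp only [shiftedFactorial, halfGamma]
  congr 2
  · push_cast; ring
  · norm_num

theorem factorial_toNat_add_one {n : ℤ} (hn : 0 ≤ n) :
    ((n + 1).toNat.factorial : ℝ) = ((n : ℝ) + 1) * (n.toNat.factorial : ℝ) := by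
  obtain ⟨m, rfl⟩ := Int.eq_ofNat_of_zero_le hn
  have : ((m : ℤ) + 1).toNat = m + 1 := by omega
  rw [this, Nat.factorial_succ]
  simp

/-- The summand, with its prefactor and normalised so that its sum over `k` is `-π`. -/
noncomputable def normalizedTerm (q r p : ℤ) (k : ℕ) : ℝ :=
  halfGamma (p + q - r + 1) * halfGamma (p - q - r) * halfGamma (k + 2 * p + 1) *
      halfGamma (k + 2 * q + 1) * halfGamma (k - 2 * q - 1) * halfGamma (k + r) *
      (6 * (k : ℝ) + 4 * (p : ℝ) + 3) /
    (halfGamma r * (k.factorial : ℝ) * (((k : ℤ) + p + q + 1).toNat.factorial : ℝ) *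
      (((k : ℤ) + p - q).toNat.factorial : ℝ) * halfGamma (k + 2 * p - 2 * r + 1) *
      (4 : ℝ) ^ ((k : ℤ) + r + 1))

/-- The quotient `normalizedTerm q r p (k + 1) / normalizedTerm q r p k`. -/
noncomputable def termRatio (q r p : ℤ) (k : ℕ) : ℝ :=
  ((k + (2 * p + 3 / 2)) / (k + (2 * p + 3 / 2 - 2 * r))) *
    ((k + (2 * q + 3 / 2)) / (k + (p + q + 2))) *
    ((k + (-2 * q - 1 / 2)) / (k + (p - q + 1))) *
    ((k + (r + 1 / 2)) / (k + 1)) *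
    ((k + (1 + (2 * p + 3 / 2) / 3)) / (k + (2 * p + 3 / 2) / 3)) * (1 / 4)

theorem normalizedTerm_succ {q r p : ℤ} (h1 : 0 ≤ p + q + 1) (h2 : 0 ≤ p - q) (k : ℕ) :
    normalizedTerm q r p (k + 1) = termRatio q r p k * normalizedTerm q r p k := by
  have hp : (0 : ℝ) ≤ p := by exact_mod_cast (by omega : (0 : ℤ) ≤ p)
  have h1' : (0 : ℝ) ≤ p + q + 1 := by exact_mod_cast h1
  have h2' : (0 : ℝ) ≤ p - q := by exact_mod_cast h2
  have hk : (0 : ℝ) ≤ k := k.cast_nonneg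
  unfold normalizedTerm termRatio
  rw [show ((k + 1 : ℕ) : ℤ) + 2 * p + 1 = (k + 2 * p + 1) + 1 by push_cast; ring,
    show ((k + 1 : ℕ) : ℤ) + 2 * q + 1 = (k + 2 * q + 1) + 1 by push_cast; ring,
    show ((k + 1 : ℕ) : ℤ) - 2 * q - 1 = (k - 2 * q - 1) + 1 by push_cast; ring,
    show ((k + 1 : ℕ) : ℤ) + r = (k + r) + 1 by push_cast; ring,
    show ((k + 1 : ℕ) : ℤ) + 2 * p - 2 * r + 1 = (k + 2 * p - 2 * r + 1) + 1 by push_cast; ring,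
    show ((k + 1 : ℕ) : ℤ) + p + q + 1 = (k + p + q + 1) + 1 by push_cast; ring,
    show ((k + 1 : ℕ) : ℤ) + p - q = (k + p - q) + 1 by push_cast; ring,
    factorial_toNat_add_one (n := k + p + q + 1) (by omega),
    factorial_toNat_add_one (n := k + p - q) (by omega),
    halfGamma_add_one (k + 2 * p + 1), halfGamma_add_one (k + 2 * q + 1),
    halfGamma_add_one (k - 2 * q - 1), halfGamma_add_one (k + r),
    halfGamma_add_one (k + 2 * p - 2 * r + 1), Nat.factorial_succ,
    zpow_add_one₀ (by norm_num) ((k : ℤ) + r + 1)]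
  push_cast
  have e1 := halfGamma_ne_zero (k + 2 * p - 2 * r + 1)
  have e2 := halfGamma_ne_zero r
  have e3 : (k : ℝ) + (2 * p + 3 / 2 - 2 * r) ≠ 0 :=
    ne_zero_of_eq_int_add_half (k + 2 * p + 1 - 2 * r) (by push_cast; ring)
  have e5 : (k : ℝ) + (p + q + 2) ≠ 0 := by
    intro h; linarith
  have e7 : (k : ℝ) + (p - q + 1) ≠ 0 := by
    intro h; linarith
  have e9 : (k : ℝ) + (2 * p + 3 / 2) / 3 ≠ 0 := by positivity
  have e10 : (k : ℝ) + 1 ≠ 0 := by positivity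
  have e12 : (4 : ℝ) ^ ((k : ℤ) + r + 1) ≠ 0 := by positivity
  have f1 : (k.factorial : ℝ) ≠ 0 := by positivity
  have f2 : (((k : ℤ) + p + q + 1).toNat.factorial : ℝ) ≠ 0 := by positivity
  have f3 : (((k : ℤ) + p - q).toNat.factorial : ℝ) ≠ 0 := by positivity
  generalize (4 : ℝ) ^ ((k : ℤ) + r + 1) = x1 at *
  generalize (k.factorial : ℝ) = x2 at *
  generalize (((k : ℤ) + p + q + 1).toNat.factorial : ℝ) = x3 at *
  generalize (((k : ℤ) + p - q).toNat.factorial : ℝ) = x4 at *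
  generalize halfGamma (k + 2 * p - 2 * r + 1) = x5 at *
  generalize halfGamma r = x6 at *
  rw [show (k : ℝ) + 2 * p - 2 * r + 1 + 1 / 2 = k + (2 * p + 3 / 2 - 2 * r) by ring,
    show (k : ℝ) + p + q + 1 + 1 = k + (p + q + 2) by ring,
    show (k : ℝ) + p - q + 1 = k + (p - q + 1) by ring,
    show (k : ℝ) + 2 * p + 1 + 1 / 2 = k + (2 * p + 3 / 2) by ring,
    show (k : ℝ) + 2 * q + 1 + 1 / 2 = k + (2 * q + 3 / 2) by ring,
    show (k : ℝ) - 2 * q - 1 + 1 / 2 = k + (-2 * q - 1 / 2) by ring,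
    show (k : ℝ) + r + 1 / 2 = k + (r + 1 / 2) by ring,
    show 6 * ((k : ℝ) + 1) + 4 * p + 3 = 6 * (k + (1 + (2 * p + 3 / 2) / 3)) by ring,
    show 6 * (k : ℝ) + 4 * p + 3 = 6 * (k + (2 * p + 3 / 2) / 3) by ring]
  generalize (k : ℝ) + (2 * p + 3 / 2 - 2 * r) = d1 at *
  generalize (k : ℝ) + (p + q + 2) = d2 at *
  generalize (k : ℝ) + (p - q + 1) = d3 at *
  generalize (k : ℝ) + (2 * p + 3 / 2) / 3 = d4 at *
  generalize (k : ℝ) + 1 = d5 at *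
  generalize (k : ℝ) + (2 * p + 3 / 2) = n1 at *
  generalize (k : ℝ) + (2 * q + 3 / 2) = n2 at *
  generalize (k : ℝ) + (-2 * q - 1 / 2) = n3 at *
  generalize (k : ℝ) + (r + 1 / 2) = n4 at *
  generalize (k : ℝ) + (1 + (2 * p + 3 / 2) / 3) = n5 at *
  rw [div_mul_div_comm, div_mul_div_comm, div_mul_div_comm, div_mul_div_comm, div_mul_div_comm,
    div_mul_div_comm, div_eq_div_iff (by simp [*]) (by simp [*])]
  ring

/-- The quotient `normalizedTerm q r (p + 1) k / normalizedTerm q r p k`. -/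
noncomputable def leftRatio (q r p : ℤ) (k : ℕ) : ℝ :=
  (p + q - r + 3 / 2) * (p - q - r + 1 / 2) * (k + (2 * p + 3 / 2)) * (k + (2 * p + 5 / 2)) *
      (k + (2 * p + 7 / 2) / 3) /
    ((k + (p + q + 2)) * (k + (p - q + 1)) * (k + (2 * p + 3 / 2 - 2 * r)) *
      (k + 1 + (2 * p + 3 / 2 - 2 * r)) * (k + (2 * p + 3 / 2) / 3))

theorem normalizedTerm_succ_left {q r p : ℤ} (h1 : 0 ≤ p + q + 1) (h2 : 0 ≤ p - q) (k : ℕ) :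
    normalizedTerm q r (p + 1) k = leftRatio q r p k * normalizedTerm q r p k := by
  have hp : (0 : ℝ) ≤ p := by exact_mod_cast (by omega : (0 : ℤ) ≤ p)
  have h1' : (0 : ℝ) ≤ p + q + 1 := by exact_mod_cast h1
  have h2' : (0 : ℝ) ≤ p - q := by exact_mod_cast h2
  have hk : (0 : ℝ) ≤ k := k.cast_nonneg
  unfold normalizedTerm leftRatio
  rw [show p + 1 + q - r + 1 = (p + q - r + 1) + 1 by ring,
    show p + 1 - q - r = (p - q - r) + 1 by ring,
    show (k : ℤ) + 2 * (p + 1) + 1 = (k + 2 * p + 1) + 1 + 1 by ring,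
    show (k : ℤ) + 2 * (p + 1) - 2 * r + 1 = (k + 2 * p - 2 * r + 1) + 1 + 1 by ring,
    show (k : ℤ) + (p + 1) + q + 1 = (k + p + q + 1) + 1 by ring,
    show (k : ℤ) + (p + 1) - q = (k + p - q) + 1 by ring,
    factorial_toNat_add_one (n := k + p + q + 1) (by omega),
    factorial_toNat_add_one (n := k + p - q) (by omega),
    halfGamma_add_one (p + q - r + 1), halfGamma_add_one (p - q - r),
    halfGamma_add_one (k + 2 * p + 1 + 1), halfGamma_add_one (k + 2 * p + 1),
    halfGamma_add_one (k + 2 * p - 2 * r + 1 + 1), halfGamma_add_one (k + 2 * p - 2 * r + 1)]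
  push_cast
  have e1 := halfGamma_ne_zero (k + 2 * p - 2 * r + 1)
  have e2 := halfGamma_ne_zero r
  have e3 : (k : ℝ) + (2 * p + 3 / 2 - 2 * r) ≠ 0 :=
    ne_zero_of_eq_int_add_half (k + 2 * p + 1 - 2 * r) (by push_cast; ring)
  have e4 : (k : ℝ) + 1 + (2 * p + 3 / 2 - 2 * r) ≠ 0 :=
    ne_zero_of_eq_int_add_half (k + 1 + 2 * p + 1 - 2 * r) (by push_cast; ring)
  have e5 : (k : ℝ) + (p + q + 2) ≠ 0 := by
    intro h; linarith
  have e7 : (k : ℝ) + (p - q + 1) ≠ 0 := by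
    intro h; linarith
  have e9 : (k : ℝ) + (2 * p + 3 / 2) / 3 ≠ 0 := by positivity
  have e12 : (4 : ℝ) ^ ((k : ℤ) + r + 1) ≠ 0 := by positivity
  have f1 : (k.factorial : ℝ) ≠ 0 := by positivity
  have f2 : (((k : ℤ) + p + q + 1).toNat.factorial : ℝ) ≠ 0 := by positivity
  have f3 : (((k : ℤ) + p - q).toNat.factorial : ℝ) ≠ 0 := by positivity
  generalize (4 : ℝ) ^ ((k : ℤ) + r + 1) = x1 at *
  generalize (k.factorial : ℝ) = x2 at *
  generalize (((k : ℤ) + p + q + 1).toNat.factorial : ℝ) = x3 at *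
  generalize (((k : ℤ) + p - q).toNat.factorial : ℝ) = x4 at *
  generalize halfGamma (k + 2 * p - 2 * r + 1) = x5 at *
  generalize halfGamma r = x6 at *
  rw [show (k : ℝ) + 2 * p - 2 * r + 1 + 1 / 2 = k + (2 * p + 3 / 2 - 2 * r) by ring,
    show (k : ℝ) + 2 * p - 2 * r + 1 + 1 + 1 / 2 = k + 1 + (2 * p + 3 / 2 - 2 * r) by ring,
    show (k : ℝ) + p + q + 1 + 1 = k + (p + q + 2) by ring,
    show (k : ℝ) + p - q + 1 = k + (p - q + 1) by ring,
    show (k : ℝ) + 2 * p + 1 + 1 / 2 = k + (2 * p + 3 / 2) by ring,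
    show (k : ℝ) + 2 * p + 1 + 1 + 1 / 2 = k + (2 * p + 5 / 2) by ring,
    show (p : ℝ) + q - r + 1 + 1 / 2 = p + q - r + 3 / 2 by ring,
    show 6 * (k : ℝ) + 4 * (p + 1) + 3 = 6 * (k + (2 * p + 7 / 2) / 3) by ring,
    show 6 * (k : ℝ) + 4 * p + 3 = 6 * (k + (2 * p + 3 / 2) / 3) by ring]
  generalize (k : ℝ) + (2 * p + 3 / 2 - 2 * r) = d1 at *
  generalize (k : ℝ) + 1 + (2 * p + 3 / 2 - 2 * r) = d5 at *
  generalize (k : ℝ) + (p + q + 2) = d2 at *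
  generalize (k : ℝ) + (p - q + 1) = d3 at *
  generalize (k : ℝ) + (2 * p + 3 / 2) / 3 = d4 at *
  generalize (k : ℝ) + (2 * p + 3 / 2) = n1 at *
  generalize (k : ℝ) + (2 * p + 5 / 2) = n2 at *
  generalize (p : ℝ) + q - r + 3 / 2 = n3 at *
  generalize (p : ℝ) - q - r + 1 / 2 = n4 at *
  generalize (k : ℝ) + (2 * p + 7 / 2) / 3 = n5 at *
  rw [div_mul_div_comm, div_eq_div_iff (by simp [*]) (by simp [*])]
  ring

/-- The rational certificate of the WZ pair for the shift `p ↦ p + 1`. -/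
noncomputable def wzCertificate (r p : ℤ) (k : ℕ) : ℝ :=
  4 / 3 * ((k / (k + (2 * p + 3 / 2) / 3)) *
    ((k + (2 * p + 3 / 2 - r)) / (k + (2 * p + 3 / 2 - 2 * r))))

theorem normalizedTerm_wz {q r p : ℤ} (h1 : 0 ≤ p + q + 1) (h2 : 0 ≤ p - q) (k : ℕ) :
    normalizedTerm q r (p + 1) k - normalizedTerm q r p k =
      wzCertificate r p (k + 1) * normalizedTerm q r p (k + 1) -
      wzCertificate r p k * normalizedTerm q r p k := by
  rw [normalizedTerm_succ h1 h2, normalizedTerm_succ_left h1 h2, termRatio, wzCertificate,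
    wzCertificate]
  have hp : (0 : ℝ) ≤ p := by exact_mod_cast (by omega : (0 : ℤ) ≤ p)
  have h1' : (0 : ℝ) ≤ p + q + 1 := by exact_mod_cast h1
  have h2' : (0 : ℝ) ≤ p - q := by exact_mod_cast h2
  have hk : (0 : ℝ) ≤ k := k.cast_nonneg
  have e3 : (k : ℝ) + (2 * p + 3 / 2 - 2 * r) ≠ 0 :=
    ne_zero_of_eq_int_add_half (k + 2 * p + 1 - 2 * r) (by push_cast; ring)
  have e4 : (k : ℝ) + 1 + (2 * p + 3 / 2 - 2 * r) ≠ 0 :=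
    ne_zero_of_eq_int_add_half (k + 1 + 2 * p + 1 - 2 * r) (by push_cast; ring)
  have e5 : (k : ℝ) + (p + q + 2) ≠ 0 := by
    intro h; linarith
  have e7 : (k : ℝ) + (p - q + 1) ≠ 0 := by
    intro h; linarith
  have e9 : (k : ℝ) + (2 * p + 3 / 2) / 3 ≠ 0 := by positivity
  have e10 : (k : ℝ) + 1 ≠ 0 := by positivity
  have e11 : (k : ℝ) + 1 + (2 * p + 3 / 2) / 3 ≠ 0 := by positivity
  push_cast
  rw [leftRatio, ← sub_one_mul, ← mul_assoc, ← sub_mul]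
  congr 1
  rw [show (k : ℝ) + (1 + (2 * p + 3 / 2) / 3) = k + 1 + (2 * p + 3 / 2) / 3 by ring]
  generalize (k : ℝ) = x at *
  generalize (p : ℝ) = a at *
  generalize (q : ℝ) = b at *
  generalize (r : ℝ) = c at *
  generalize h3 : x + (2 * a + 3 / 2 - 2 * c) = d3 at *
  generalize h4 : x + 1 + (2 * a + 3 / 2 - 2 * c) = d4 at *
  generalize h5 : x + (a + b + 2) = d5 at *
  generalize h7 : x + (a - b + 1) = d7 at *
  generalize h9 : x + (2 * a + 3 / 2) / 3 = d9 at *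
  generalize h11 : x + 1 + (2 * a + 3 / 2) / 3 = d11 at *
  field_simp
  subst h3 h4 h5 h7 h9
  ring

theorem tendsto_add_div_add {ι : Type*} {l : Filter ι} {u : ι → ℝ} (hu : Tendsto u l atTop)
    (x y : ℝ) : Tendsto (fun i => (u i + x) / (u i + y)) l (𝓝 1) := by
  have h1 : Tendsto (fun i => u i + y) l atTop := tendsto_atTop_add_const_right l y hu
  have h2 : Tendsto (fun i => 1 + (x - y) / (u i + y)) l (𝓝 (1 + 0)) :=
    tendsto_const_nhds.add (h1.const_div_atTop (x - y))
  rw [add_zero] at h2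
  refine h2.congr' ?_
  filter_upwards [h1.eventually_gt_atTop 0] with i hi
  field_simp
  ring

theorem tendsto_termRatio (q r p : ℤ) : Tendsto (termRatio q r p) atTop (𝓝 (1 / 4)) := by
  have h := fun x y => tendsto_add_div_add (tendsto_natCast_atTop_atTop (R := ℝ)) x y
  have h' := (((((h (2 * p + 3 / 2) (2 * p + 3 / 2 - 2 * r)).mul
    (h (2 * q + 3 / 2) (p + q + 2))).mul (h (-2 * q - 1 / 2) (p - q + 1))).mul
    (h (r + 1 / 2) 1)).mul
    (h (1 + (2 * p + 3 / 2) / 3) ((2 * p + 3 / 2) / 3))).mul_const (1 / 4)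
  simp only [one_mul, mul_one] at h'
  exact h'

theorem normalizedTerm_ne_zero (q r p : ℤ) (k : ℕ) : normalizedTerm q r p k ≠ 0 := by
  have h6 : 6 * (k : ℝ) + 4 * (p : ℝ) + 3 ≠ 0 := by
    have : (6 * k + 4 * p + 3 : ℤ) ≠ 0 := by omega
    exact_mod_cast this
  simp only [normalizedTerm, ne_eq, div_eq_zero_iff, mul_eq_zero, halfGamma_ne_zero, h6,
    Nat.cast_eq_zero, Nat.factorial_ne_zero, or_self, false_or]
  positivity

theorem summable_normalizedTerm {q r p : ℤ} (h1 : 0 ≤ p + q + 1) (h2 : 0 ≤ p - q) :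
    Summable (normalizedTerm q r p) := by
  refine summable_of_ratio_test_tendsto_lt_one (l := 1 / 4) (by norm_num)
    (Eventually.of_forall (normalizedTerm_ne_zero q r p)) ?_
  have h := (tendsto_termRatio q r p).norm
  rw [Real.norm_of_nonneg (by norm_num)] at h
  refine h.congr fun k => ?_
  rw [normalizedTerm_succ h1 h2, norm_mul,
    mul_div_cancel_right₀ _ (norm_ne_zero_iff.2 (normalizedTerm_ne_zero q r p k))]

theorem tendsto_wzCertificate (r p : ℤ) : Tendsto (wzCertificate r p) atTop (𝓝 (4 / 3)) := by
  have h := fun x y => tendsto_add_div_add (tendsto_natCast_atTop_atTop (R := ℝ)) x y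
  have h' := ((h 0 ((2 * p + 3 / 2) / 3)).mul
    (h (2 * p + 3 / 2 - r) (2 * p + 3 / 2 - 2 * r))).const_mul (4 / 3)
  simp only [add_zero, mul_one] at h'
  exact h'

theorem tsum_normalizedTerm_succ_left {q r p : ℤ} (h1 : 0 ≤ p + q + 1) (h2 : 0 ≤ p - q) :
    ∑' k, normalizedTerm q r (p + 1) k = ∑' k, normalizedTerm q r p k := by
  have s0 := summable_normalizedTerm (r := r) h1 h2
  have s1 := summable_normalizedTerm (q := q) (r := r) (p := p + 1) (by omega) (by omega)
  have hlim := (s1.sub s0).hasSum.tendsto_sum_nat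
  have hG : Tendsto (fun n => ∑ k ∈ Finset.range n,
      (normalizedTerm q r (p + 1) k - normalizedTerm q r p k)) atTop (𝓝 0) := by
    have h := (tendsto_wzCertificate r p).mul s0.tendsto_atTop_zero
    rw [mul_zero] at h
    refine h.congr fun n => ?_
    simp only [normalizedTerm_wz h1 h2]
    rw [Finset.sum_range_sub (fun k => wzCertificate r p k * normalizedTerm q r p k)]
    simp [wzCertificate]
  have := tendsto_nhds_unique hlim hG
  rw [s1.tsum_sub s0] at this
  linarith

theorem tsum_normalizedTerm_eq_of_le {q r p P : ℤ} (h1 : 0 ≤ p + q + 1) (h2 : 0 ≤ p - q)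
    (hP : p ≤ P) : ∑' k, normalizedTerm q r P k = ∑' k, normalizedTerm q r p k := by
  induction P, hP using Int.leInduction with
  | base => rfl
  | succ n hn ih => rw [tsum_normalizedTerm_succ_left (by omega) (by omega), ih]

theorem tendsto_termRatio_left (q r : ℤ) (k : ℕ) :
    Tendsto (fun P : ℤ => termRatio q r P k) atTop (𝓝 0) := by
  have hP : Tendsto (fun P : ℤ => (P : ℝ)) atTop atTop := tendsto_intCast_atTop_atTop
  have h1 := tendsto_add_div_add (hP.const_mul_atTop (two_pos : (0 : ℝ) < 2))
    (k + 3 / 2) (k + 3 / 2 - 2 * r)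
  have h2 := (tendsto_atTop_add_const_right _ (k + q + 2 : ℝ) hP).const_div_atTop
    (k + (2 * q + 3 / 2) : ℝ)
  have h3 := (tendsto_atTop_add_const_right _ (k - q + 1 : ℝ) hP).const_div_atTop
    (k + (-2 * q - 1 / 2) : ℝ)
  have h4 : Tendsto (fun _ : ℤ => ((k : ℝ) + (r + 1 / 2)) / (k + 1)) atTop (𝓝 _) :=
    tendsto_const_nhds
  have h5 := tendsto_add_div_add (hP.const_mul_atTop (by norm_num : (0 : ℝ) < 2 / 3))
    (k + 3 / 2) (k + 1 / 2)
  have h := ((((h1.mul h2).mul h3).mul h4).mul h5).mul_const (1 / 4)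
  simp only [mul_zero, zero_mul] at h
  refine h.congr fun P => ?_
  rw [termRatio, show (k : ℝ) + (2 * P + 3 / 2) = 2 * P + (k + 3 / 2) by ring,
    show (k : ℝ) + (2 * P + 3 / 2 - 2 * r) = 2 * P + (k + 3 / 2 - 2 * r) by ring,
    show (k : ℝ) + (P + q + 2) = P + (k + q + 2) by ring,
    show (k : ℝ) + (P - q + 1) = P + (k - q + 1) by ring,
    show (k : ℝ) + (1 + (2 * P + 3 / 2) / 3) = 2 / 3 * P + (k + 3 / 2) by ring,
    show (k : ℝ) + (2 * P + 3 / 2) / 3 = 2 / 3 * P + (k + 1 / 2) by ring]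

theorem abs_div_le_of_abs_le {x y c : ℝ} (hy : 0 < y) (h : |x| ≤ c * y) : |x / y| ≤ c := by
  rw [abs_div, abs_of_pos hy]
  exact (div_le_iff₀ hy).2 h

theorem eventually_abs_termRatio_le (q r : ℤ) :
    ∀ᶠ P : ℤ in atTop, ∀ k : ℕ,
      |termRatio q r P k| ≤ (k + |(r : ℝ) + 1 / 2|) / (k + 1) * (25 / 64) := by
  filter_upwards [eventually_ge_atTop (10 * (|q| + |r|) + 12)] with P hP k
  have hP' : 10 * (|(q : ℝ)| + |(r : ℝ)|) + 12 ≤ P := by exact_mod_cast hP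
  have hk : (0 : ℝ) ≤ k := k.cast_nonneg
  obtain ⟨q1, q2⟩ := abs_le.1 (le_refl |(q : ℝ)|)
  obtain ⟨r1, r2⟩ := abs_le.1 (le_refl |(r : ℝ)|)
  have hq := abs_nonneg (q : ℝ)
  have hr := abs_nonneg (r : ℝ)
  have h1 : |((k : ℝ) + (2 * P + 3 / 2)) / (k + (2 * P + 3 / 2 - 2 * r))| ≤ 5 / 4 :=
    abs_div_le_of_abs_le (by linarith) (abs_le.2 ⟨by linarith, by linarith⟩)
  have h2 : |((k : ℝ) + (2 * q + 3 / 2)) / (k + (P + q + 2))| ≤ 1 :=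
    abs_div_le_of_abs_le (by linarith) (abs_le.2 ⟨by linarith, by linarith⟩)
  have h3 : |((k : ℝ) + (-2 * q - 1 / 2)) / (k + (P - q + 1))| ≤ 1 :=
    abs_div_le_of_abs_le (by linarith) (abs_le.2 ⟨by linarith, by linarith⟩)
  have h4 : |((k : ℝ) + (r + 1 / 2)) / (k + 1)| ≤ (k + |(r : ℝ) + 1 / 2|) / (k + 1) := by
    rw [abs_div, abs_of_pos (by linarith : (0 : ℝ) < k + 1)]
    gcongr
    exact (abs_add_le _ _).trans_eq (by rw [abs_of_nonneg hk])
  have h5 : |((k : ℝ) + (1 + (2 * P + 3 / 2) / 3)) / (k + (2 * P + 3 / 2) / 3)| ≤ 5 / 4 :=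
    abs_div_le_of_abs_le (by linarith) (abs_le.2 ⟨by linarith, by linarith⟩)
  unfold termRatio
  rw [abs_mul, abs_mul, abs_mul, abs_mul, abs_mul, abs_of_pos (by norm_num : (0 : ℝ) < 1 / 4)]
  calc _ ≤ 5 / 4 * 1 * 1 * ((k + |(r : ℝ) + 1 / 2|) / (k + 1)) * (5 / 4) * (1 / 4) := by gcongr
    _ = _ := by ring

theorem Gamma_add_nat_add_one {s : ℝ} (hs : ∀ m : ℕ, s ≠ -m) (n : ℕ) :
    Real.Gamma (s + n + 1) = (∏ j ∈ Finset.range (n + 1), (s + j)) * Real.Gamma s := by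
  induction n with
  | zero =>
    have := hs 0
    simp only [Nat.cast_zero, neg_zero] at this
    simp [Real.Gamma_add_one this]
  | succ n ih =>
    have h : s + (n + 1 : ℕ) ≠ 0 := fun h => hs (n + 1) (by linarith)
    rw [Real.Gamma_add_one h, Finset.prod_range_succ, mul_right_comm, ← ih, mul_comm]
    congr 2
    push_cast
    ring

theorem tendsto_Gamma_div_factorial_mul_rpow {s : ℝ} (hs : ∀ m : ℕ, s ≠ -m) :
    Tendsto (fun n : ℕ => Real.Gamma (s + n + 1) / (n.factorial * (n : ℝ) ^ s)) atTop (𝓝 1) := by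
  have hG := Real.Gamma_ne_zero hs
  have h := (tendsto_const_nhds (x := Real.Gamma s)).div (Real.GammaSeq_tendsto_Gamma s) hG
  rw [div_self hG] at h
  refine h.congr fun n => ?_
  rw [Pi.div_apply, Real.GammaSeq, Gamma_add_nat_add_one hs, div_div_eq_mul_div,
    mul_comm (Real.Gamma s), mul_comm ((n : ℝ) ^ s)]

theorem tendsto_halfGamma_div (j : ℤ) :
    Tendsto (fun N : ℤ => halfGamma (N + j) / (N.toNat.factorial * (N : ℝ) ^ ((j : ℝ) - 1 / 2)))
      atTop (𝓝 1) := by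
  have hs : ∀ m : ℕ, (j : ℝ) - 1 / 2 ≠ -m := fun m => by
    have := int_add_half_ne_neg_nat (j - 1) m
    push_cast at this
    convert this using 1
    ring
  have hN : Tendsto Int.toNat atTop atTop :=
    tendsto_atTop_atTop.2 fun b => ⟨b, fun a ha => by omega⟩
  refine ((tendsto_Gamma_div_factorial_mul_rpow hs).comp hN).congr' ?_
  filter_upwards [eventually_ge_atTop 0] with N hN0
  obtain ⟨n, rfl⟩ := Int.eq_ofNat_of_zero_le hN0
  simp only [Function.comp_apply, Int.toNat_natCast, halfGamma]
  congr 2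
  push_cast
  ring

theorem tendsto_rpow_part (q r : ℤ) :
    Tendsto (fun P : ℤ =>
      ((P + q + 1 : ℤ) : ℝ) ^ (((-r : ℤ) : ℝ) - 1 / 2) *
        ((P - q : ℤ) : ℝ) ^ (((-r : ℤ) : ℝ) - 1 / 2) *
        (((2 * P : ℤ) : ℝ) ^ (((1 : ℤ) : ℝ) - 1 / 2) /
          ((2 * P : ℤ) : ℝ) ^ (((1 - 2 * r : ℤ) : ℝ) - 1 / 2)) *
        ((4 * P + 3) / 4 ^ (r + 1))) atTop (𝓝 1) := by
  have hP : Tendsto (fun P : ℤ => (P : ℝ)) atTop atTop := tendsto_intCast_atTop_atTop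
  set s : ℝ := ((-r : ℤ) : ℝ) - 1 / 2 with hs
  have h1 := (tendsto_add_div_add hP (q + 1) 0).rpow_const (p := s) (Or.inl one_ne_zero)
  have h2 := (tendsto_add_div_add hP (-q) 0).rpow_const (p := s) (Or.inl one_ne_zero)
  have h := (h1.mul h2).mul (tendsto_add_div_add hP (3 / 4) 0)
  simp only [Real.one_rpow, mul_one, add_zero] at h
  refine h.congr' ?_
  filter_upwards [eventually_gt_atTop 0, eventually_ge_atTop (-q - 1), eventually_ge_atTop q]
    with P p0 p1 p2
  have p0' : (0 : ℝ) < P := by exact_mod_cast p0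
  have p1' : (0 : ℝ) ≤ P + (q + 1) := by exact_mod_cast (by omega : 0 ≤ P + (q + 1))
  have p2' : (0 : ℝ) ≤ P + -q := by exact_mod_cast (by omega : 0 ≤ P + -q)
  rw [Real.div_rpow p1' p0'.le, Real.div_rpow p2' p0'.le]
  have e1 : ((P + q + 1 : ℤ) : ℝ) = P + (q + 1) := by push_cast; ring
  have e2 : ((P - q : ℤ) : ℝ) = P + -q := by push_cast; ring
  rw [e1, e2, ← Real.rpow_sub (by push_cast; linarith),
    show ((1 : ℤ) : ℝ) - 1 / 2 - (((1 - 2 * r : ℤ) : ℝ) - 1 / 2) = ((2 * r : ℤ) : ℝ) by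
      push_cast; ring, Real.rpow_intCast]
  have e3 : (P : ℝ) ^ s * (P : ℝ) ^ s = ((P : ℝ) ^ (2 * r) * P)⁻¹ := by
    rw [← Real.rpow_add p0', show s + s = ((-(2 * r + 1) : ℤ) : ℝ) by rw [hs]; push_cast; ring,
      Real.rpow_intCast, zpow_neg, zpow_add_one₀ p0'.ne']
  have e4 : ((2 * P : ℤ) : ℝ) ^ (2 * r) = 4 ^ r * (P : ℝ) ^ (2 * r) := by
    push_cast
    rw [mul_zpow, zpow_mul (2 : ℝ)]
    norm_num
  rw [e4, zpow_add_one₀ (by norm_num : (4 : ℝ) ≠ 0), div_mul_div_comm, e3]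
  have : (P : ℝ) ^ (2 * r) ≠ 0 := zpow_ne_zero _ p0'.ne'
  field_simp

theorem normalizedTerm_zero_eq {q r P : ℤ} (p0 : 0 < P) (p1 : -q - 1 < P) (p2 : q < P) :
    normalizedTerm q r P 0 = -Real.pi *
      (halfGamma (P + q + 1 + -r) /
          ((P + q + 1).toNat.factorial *
            ((P + q + 1 : ℤ) : ℝ) ^ (((-r : ℤ) : ℝ) - 1 / 2)) *
        (halfGamma (P - q + -r) /
          ((P - q).toNat.factorial * ((P - q : ℤ) : ℝ) ^ (((-r : ℤ) : ℝ) - 1 / 2))) *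
        (halfGamma (2 * P + 1) /
            ((2 * P).toNat.factorial * ((2 * P : ℤ) : ℝ) ^ (((1 : ℤ) : ℝ) - 1 / 2)) /
          (halfGamma (2 * P + (1 - 2 * r)) /
            ((2 * P).toNat.factorial *
              ((2 * P : ℤ) : ℝ) ^ (((1 - 2 * r : ℤ) : ℝ) - 1 / 2)))) *
        (((P + q + 1 : ℤ) : ℝ) ^ (((-r : ℤ) : ℝ) - 1 / 2) *
          ((P - q : ℤ) : ℝ) ^ (((-r : ℤ) : ℝ) - 1 / 2) *
          (((2 * P : ℤ) : ℝ) ^ (((1 : ℤ) : ℝ) - 1 / 2) /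
            ((2 * P : ℤ) : ℝ) ^ (((1 - 2 * r : ℤ) : ℝ) - 1 / 2)) *
          ((4 * P + 3) / 4 ^ (r + 1)))) := by
  have p0' : (0 : ℝ) < ((2 * P : ℤ) : ℝ) := by exact_mod_cast (by omega : 0 < 2 * P)
  have p1' : (0 : ℝ) < ((P + q + 1 : ℤ) : ℝ) := by exact_mod_cast (by omega : 0 < P + q + 1)
  have p2' : (0 : ℝ) < ((P - q : ℤ) : ℝ) := by exact_mod_cast (by omega : 0 < P - q)
  have a1 := (Real.rpow_pos_of_pos p1' (((-r : ℤ) : ℝ) - 1 / 2)).ne'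
  have a2 := (Real.rpow_pos_of_pos p2' (((-r : ℤ) : ℝ) - 1 / 2)).ne'
  have a3 := (Real.rpow_pos_of_pos p0' (((1 : ℤ) : ℝ) - 1 / 2)).ne'
  have a4 := (Real.rpow_pos_of_pos p0' (((1 - 2 * r : ℤ) : ℝ) - 1 / 2)).ne'
  have b1 : ((P + q + 1).toNat.factorial : ℝ) ≠ 0 := by positivity
  have b2 : ((P - q).toNat.factorial : ℝ) ≠ 0 := by positivity
  have b3 : ((2 * P).toNat.factorial : ℝ) ≠ 0 := by positivity
  have c1 := halfGamma_ne_zero r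
  have c2 := halfGamma_ne_zero (2 * P - 2 * r + 1)
  have c3 : (4 : ℝ) ^ (r + 1) ≠ 0 := by positivity
  rw [normalizedTerm]
  simp only [Nat.cast_zero, zero_add, Nat.factorial_zero,
    Nat.cast_one, mul_zero, mul_one, zero_sub]
  rw [show P + q + 1 + -r = P + q - r + 1 by ring, show P - q + -r = P - q - r by ring,
    show 2 * P + (1 - 2 * r) = 2 * P - 2 * r + 1 by ring,
    ← halfGamma_mul_reflection q, show -2 * q - 1 = -(2 * q) - 1 by ring]
  generalize ((P + q + 1 : ℤ) : ℝ) ^ (((-r : ℤ) : ℝ) - 1 / 2) = y1 at *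
  generalize ((P - q : ℤ) : ℝ) ^ (((-r : ℤ) : ℝ) - 1 / 2) = y2 at *
  generalize ((2 * P : ℤ) : ℝ) ^ (((1 : ℤ) : ℝ) - 1 / 2) = y3 at *
  generalize ((2 * P : ℤ) : ℝ) ^ (((1 - 2 * r : ℤ) : ℝ) - 1 / 2) = y4 at *
  generalize ((P + q + 1).toNat.factorial : ℝ) = z1 at *
  generalize ((P - q).toNat.factorial : ℝ) = z2 at *
  generalize ((2 * P).toNat.factorial : ℝ) = z3 at *
  generalize halfGamma r = z4 at *
  generalize halfGamma (2 * P - 2 * r + 1) = z5 at *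
  generalize (4 : ℝ) ^ (r + 1) = z6 at *
  generalize halfGamma (P + q - r + 1) = w1
  generalize halfGamma (P - q - r) = w2
  generalize halfGamma (2 * P + 1) = w3
  generalize halfGamma (2 * q + 1) = w4
  generalize halfGamma (-(2 * q) - 1) = w5
  rw [div_div_div_eq, div_mul_div_comm, div_mul_div_comm, mul_div_assoc' (y1 * y2),
    div_mul_div_comm, div_mul_div_comm, mul_div_assoc', div_eq_div_iff (by simp [*]) (by simp [*])]
  ring

theorem tendsto_normalizedTerm_zero (q r : ℤ) :
    Tendsto (fun P : ℤ => normalizedTerm q r P 0) atTop (𝓝 (-Real.pi)) := by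
  have t1 : Tendsto (fun P : ℤ => P + q + 1) atTop atTop :=
    tendsto_atTop_atTop.2 fun b => ⟨b - q - 1, fun a ha => by omega⟩
  have t2 : Tendsto (fun P : ℤ => P - q) atTop atTop :=
    tendsto_atTop_atTop.2 fun b => ⟨b + q, fun a ha => by omega⟩
  have t3 : Tendsto (fun P : ℤ => 2 * P) atTop atTop :=
    tendsto_atTop_atTop.2 fun b => ⟨max b 0, fun a ha => by omega⟩
  have h1 := (tendsto_halfGamma_div (-r)).comp t1
  have h2 := (tendsto_halfGamma_div (-r)).comp t2
  have h3 := (tendsto_halfGamma_div 1).comp t3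
  have h4 := (tendsto_halfGamma_div (1 - 2 * r)).comp t3
  have h := (((h1.mul h2).mul (h3.div h4 one_ne_zero)).mul
    (tendsto_rpow_part q r)).const_mul (-Real.pi)
  simp only [div_one, mul_one] at h
  refine h.congr' ?_
  filter_upwards [eventually_gt_atTop 0, eventually_gt_atTop (-q - 1), eventually_gt_atTop q]
    with P p0 p1 p2
  rw [normalizedTerm_zero_eq p0 p1 p2]
  simp only [Function.comp_apply, Pi.div_apply]

theorem tendsto_normalizedTerm_add_one (q r : ℤ) (k : ℕ) :
    Tendsto (fun P : ℤ => normalizedTerm q r P (k + 1)) atTop (𝓝 0) := by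
  have step : ∀ (k : ℕ) {c : ℝ}, Tendsto (fun P : ℤ => normalizedTerm q r P k) atTop (𝓝 c) →
      Tendsto (fun P : ℤ => normalizedTerm q r P (k + 1)) atTop (𝓝 0) := by
    intro k c hc
    have h := (tendsto_termRatio_left q r k).mul hc
    rw [zero_mul] at h
    refine h.congr' ?_
    filter_upwards [eventually_ge_atTop (-q - 1), eventually_ge_atTop q] with P p1 p2
    rw [normalizedTerm_succ (by omega) (by omega)]
  induction k with
  | zero => exact step 0 (tendsto_normalizedTerm_zero q r)
  | succ k ih => exact step (k + 1) ih

theorem summable_prod_of_tendsto {ρ : ℕ → ℝ} {l : ℝ} (hl : l < 1) (h0 : ∀ k, 0 < ρ k)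
    (h : Tendsto ρ atTop (𝓝 l)) : Summable fun n => ∏ k ∈ Finset.range n, ρ k := by
  have hpos : ∀ n, 0 < ∏ k ∈ Finset.range n, ρ k := fun n => Finset.prod_pos fun k _ => h0 k
  refine summable_of_ratio_test_tendsto_lt_one hl (Eventually.of_forall fun n => (hpos n).ne') ?_
  refine h.congr fun n => ?_
  rw [Real.norm_of_nonneg (hpos _).le, Real.norm_of_nonneg (hpos _).le, Finset.prod_range_succ,
    mul_div_cancel_left₀ _ (hpos n).ne']

theorem tendsto_tsum_normalizedTerm (q r : ℤ) :
    Tendsto (fun P : ℤ => ∑' k, normalizedTerm q r P k) atTop (𝓝 (-Real.pi)) := by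
  set ρ : ℕ → ℝ := fun k => (k + |(r : ℝ) + 1 / 2|) / (k + 1) * (25 / 64) with hρ
  have hD : 0 < |(r : ℝ) + 1 / 2| := abs_pos.2 (int_add_half_ne_zero r)
  have hρ0 : ∀ k, 0 < ρ k := fun k => by positivity
  have hρlim : Tendsto ρ atTop (𝓝 (25 / 64)) := by
    have := (tendsto_add_div_add (tendsto_natCast_atTop_atTop (R := ℝ))
      |(r : ℝ) + 1 / 2| 1).mul_const (25 / 64)
    rwa [one_mul] at this
  have hsum := (summable_prod_of_tendsto (by norm_num) hρ0 hρlim).mul_left (Real.pi + 1)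
  have hzero : ∀ᶠ P : ℤ in atTop, |normalizedTerm q r P 0| ≤ Real.pi + 1 := by
    have h := (tendsto_normalizedTerm_zero q r).abs
    rw [abs_neg, abs_of_pos Real.pi_pos] at h
    exact (h.eventually_lt_const (lt_add_one _)).mono fun _ => le_of_lt
  have key := tendsto_tsum_of_dominated_convergence (𝓕 := atTop)
    (f := fun P : ℤ => normalizedTerm q r P) (g := fun k => if k = 0 then -Real.pi else 0) hsum
    (fun k => by
      cases k with
      | zero => simpa using tendsto_normalizedTerm_zero q r
      | succ k => simpa using tendsto_normalizedTerm_add_one q r k) (by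
      filter_upwards [hzero, eventually_abs_termRatio_le q r, eventually_ge_atTop (-q - 1),
        eventually_ge_atTop q] with P hP0 hP p1 p2 k
      rw [Real.norm_eq_abs]
      induction k with
      | zero => simpa using hP0
      | succ k ih =>
        rw [normalizedTerm_succ (by omega) (by omega), abs_mul, Finset.prod_range_succ,
          ← mul_assoc, mul_comm]
        exact mul_le_mul ih (hP k) (abs_nonneg _) ((abs_nonneg _).trans ih))
  rwa [tsum_ite_eq] at key

theorem tsum_normalizedTerm {q r p : ℤ} (h1 : 0 ≤ p + q + 1) (h2 : 0 ≤ p - q) :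
    ∑' k, normalizedTerm q r p k = -Real.pi := by
  refine tendsto_nhds_unique (tendsto_const_nhds.congr' ?_) (tendsto_tsum_normalizedTerm q r)
  filter_upwards [eventually_ge_atTop p] with P hP
  exact (tsum_normalizedTerm_eq_of_le h1 h2 hP).symm

theorem wei_gong_thm2 (p q r : ℤ)
    (h : 0 ≤ min (p + q + 1) (p - q)) :
    1 / Real.pi =
      (shiftedFactorial (1/2) (p + q - r + 1) * shiftedFactorial (1/2) (p - q - r) /
        shiftedFactorial (1/2) r) *
      ∑' k : ℕ,
        (shiftedFactorial (3/2) ((k : ℤ) + 2*p) * shiftedFactorial (3/2) ((k : ℤ) + 2*q) *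
          shiftedFactorial (-(1/2)) ((k : ℤ) - 2*q) * shiftedFactorial (1/2) ((k : ℤ) + r)) /
        ((k.factorial : ℝ) * (((k : ℤ) + p + q + 1).toNat.factorial : ℝ) *
          (((k : ℤ) + p - q).toNat.factorial : ℝ) *
          shiftedFactorial (3/2) ((k : ℤ) + 2*p - 2*r)) *
        ((6*(k : ℝ) + 4*(p : ℝ) + 3) / (4 : ℝ) ^ ((k : ℤ) + r + 1)) := by
  obtain ⟨h1, h2⟩ := le_min_iff.1 h
  have hS := tsum_normalizedTerm (r := r) h1 h2
  have hg0 : halfGamma 0 * halfGamma 0 = Real.pi := by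
    rw [halfGamma_zero, Real.mul_self_sqrt Real.pi_pos.le]
  have hg1 : halfGamma 1 * halfGamma (-1) = -Real.pi := by
    simpa using halfGamma_mul_reflection 0
  have hpi := Real.pi_ne_zero
  have n0 := halfGamma_ne_zero 0
  have n1 := halfGamma_ne_zero 1
  have n2 := halfGamma_ne_zero (-1)
  have n3 := halfGamma_ne_zero r
  have hc : (1 : ℝ) / Real.pi = (-(1 / (Real.pi * Real.pi))) * (-Real.pi) := by
    field_simp
  rw [hc, ← hS, ← tsum_mul_left, ← tsum_mul_left]
  refine tsum_congr fun k => ?_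
  have hc' : -(1 / (Real.pi * Real.pi)) =
      1 / (halfGamma 0 * halfGamma 0 * (halfGamma 1 * halfGamma (-1))) := by
    rw [hg0, hg1]
    field_simp
  rw [hc', normalizedTerm]
  simp only [shiftedFactorial_half, shiftedFactorial_three_halves, shiftedFactorial_neg_half]
  have f1 : (k.factorial : ℝ) ≠ 0 := by positivity
  have f2 : (((k : ℤ) + p + q + 1).toNat.factorial : ℝ) ≠ 0 := by positivity
  have f3 : (((k : ℤ) + p - q).toNat.factorial : ℝ) ≠ 0 := by positivity
  have f4 : (4 : ℝ) ^ ((k : ℤ) + r + 1) ≠ 0 := by positivity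
  have f5 := halfGamma_ne_zero (k + 2 * p - 2 * r + 1)
  generalize (4 : ℝ) ^ ((k : ℤ) + r + 1) = x1 at *
  generalize (k.factorial : ℝ) = x2 at *
  generalize (((k : ℤ) + p + q + 1).toNat.factorial : ℝ) = x3 at *
  generalize (((k : ℤ) + p - q).toNat.factorial : ℝ) = x4 at *
  generalize halfGamma (k + 2 * p - 2 * r + 1) = x5 at *
  generalize halfGamma r = x6 at *
  generalize halfGamma 0 = x7 at *
  generalize halfGamma 1 = x8 at *
  generalize halfGamma (-1) = x9 at *
  field_simp
end

section
/- For all integers p, q with min{p+q+1, p−q} ≥ 0, one has 4^{p+2}/(√2·π) = ∑_{k=0}^∞ [(3/2)_{k+2p} (3/2)_{k+2q} (−1/2)_{k−2q}] / [k! · (k+p+q+1)! · (k+p−q)!] · (6k+4p+3)/(−8)^k. -/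
open Filter Topology

theorem shiftedFactorial_add_one {x : ℝ} {n : ℤ} (h : x + n ≠ 0) :
    shiftedFactorial x (n + 1) = (x + n) * shiftedFactorial x n := by
  unfold shiftedFactorial
  push_cast
  rw [← add_assoc, Real.Gamma_add_one h, mul_div_assoc]

theorem three_halves_add_int_ne_zero (n : ℤ) : (3 / 2 : ℝ) + n ≠ 0 := by
  intro h
  have h2 : ((3 + 2 * n : ℤ) : ℝ) = 0 := by push_cast; linarith
  have h3 : 3 + 2 * n = 0 := by exact_mod_cast h2
  omega

theorem neg_half_add_int_ne_zero (n : ℤ) : (-(1 / 2) : ℝ) + n ≠ 0 := by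
  have := three_halves_add_int_ne_zero (n - 2)
  push_cast at this
  intro h
  apply this
  linarith

theorem toNat_factorial_add_one {n : ℤ} (hn : 0 ≤ n) :
    ((n + 1).toNat.factorial : ℝ) = (n + 1) * (n.toNat.factorial : ℝ) := by
  lift n to ℕ using hn
  have : ((n : ℤ) + 1).toNat = n + 1 := by omega
  rw [this, Nat.factorial_succ]
  push_cast
  simp

/-- The summand of the series without its factor `6 k + 4 p + 3`. -/
noncomputable def hyperTerm (p q : ℤ) (k : ℕ) : ℝ :=
  (shiftedFactorial (3/2) ((k : ℤ) + 2*p) * shiftedFactorial (3/2) ((k : ℤ) + 2*q) *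
    shiftedFactorial (-(1/2)) ((k : ℤ) - 2*q)) /
  ((k.factorial : ℝ) * (((k : ℤ) + p + q + 1).toNat.factorial : ℝ) *
    (((k : ℤ) + p - q).toNat.factorial : ℝ)) / (-8 : ℝ) ^ k

theorem hyperTerm_succ {p q : ℤ} (h₁ : 0 ≤ p + q + 1) (h₂ : 0 ≤ p - q) (k : ℕ) :
    hyperTerm p q (k + 1) =
      -((3/2 + 2*p + k) * ((3/2 + 2*q + k) * (-(1/2) - 2*q + k))) /
        (8 * (k + 1) * ((k + p + q + 2) * (k + p - q + 1))) * hyperTerm p q k := by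
  have e₁ : ((k + 1 : ℕ) : ℤ) + 2 * p = (k + 2 * p) + 1 := by push_cast; ring
  have e₂ : ((k + 1 : ℕ) : ℤ) + 2 * q = (k + 2 * q) + 1 := by push_cast; ring
  have e₃ : ((k + 1 : ℕ) : ℤ) - 2 * q = (k - 2 * q) + 1 := by push_cast; ring
  have e₄ : ((k + 1 : ℕ) : ℤ) + p + q + 1 = (k + p + q + 1) + 1 := by push_cast; ring
  have e₅ : ((k + 1 : ℕ) : ℤ) + p - q = (k + p - q) + 1 := by push_cast; ring
  have m₁ : (0 : ℝ) ≤ p + q + 1 := by exact_mod_cast h₁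
  have m₂ : (0 : ℝ) ≤ p - q := by exact_mod_cast h₂
  have hk : (0 : ℝ) ≤ k := k.cast_nonneg
  have d₁ : (k + p + q + 2 : ℝ) ≠ 0 := by linarith
  have d₂ : (k + p - q + 1 : ℝ) ≠ 0 := by linarith
  have d₃ : (k + p + q + 1 + 1 : ℝ) ≠ 0 := by linarith
  unfold hyperTerm
  rw [e₁, e₂, e₃, e₄, e₅, shiftedFactorial_add_one (three_halves_add_int_ne_zero _),
    shiftedFactorial_add_one (three_halves_add_int_ne_zero _),
    shiftedFactorial_add_one (neg_half_add_int_ne_zero _),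
    toNat_factorial_add_one (n := k + p + q + 1) (by omega),
    toNat_factorial_add_one (n := k + p - q) (by omega), Nat.factorial_succ, pow_succ]
  push_cast
  generalize shiftedFactorial (3/2) ((k : ℤ) + 2*p) = A
  generalize shiftedFactorial (3/2) ((k : ℤ) + 2*q) = B
  generalize shiftedFactorial (-(1/2)) ((k : ℤ) - 2*q) = C
  field_simp
  ring

theorem hyperTerm_add_one_left {p q : ℤ} (h₁ : 0 ≤ p + q + 1) (h₂ : 0 ≤ p - q) (k : ℕ) :
    hyperTerm (p + 1) q k =
      (3/2 + 2*p + k) * (5/2 + 2*p + k) / ((k + p + q + 2) * (k + p - q + 1)) *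
        hyperTerm p q k := by
  have e₁ : (k : ℤ) + 2 * (p + 1) = (k + 2 * p) + 1 + 1 := by ring
  have e₄ : (k : ℤ) + (p + 1) + q + 1 = (k + p + q + 1) + 1 := by ring
  have e₅ : (k : ℤ) + (p + 1) - q = (k + p - q) + 1 := by ring
  have m₁ : (0 : ℝ) ≤ p + q + 1 := by exact_mod_cast h₁
  have m₂ : (0 : ℝ) ≤ p - q := by exact_mod_cast h₂
  have hk : (0 : ℝ) ≤ k := k.cast_nonneg
  have d₁ : (k + p + q + 2 : ℝ) ≠ 0 := by linarith
  have d₂ : (k + p - q + 1 : ℝ) ≠ 0 := by linarith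
  have d₃ : (k + p + q + 1 + 1 : ℝ) ≠ 0 := by linarith
  unfold hyperTerm
  rw [e₁, e₄, e₅, shiftedFactorial_add_one (three_halves_add_int_ne_zero _),
    shiftedFactorial_add_one (three_halves_add_int_ne_zero _),
    toNat_factorial_add_one (n := k + p + q + 1) (by omega),
    toNat_factorial_add_one (n := k + p - q) (by omega)]
  push_cast
  generalize shiftedFactorial (3/2) ((k : ℤ) + 2*p) = A
  generalize shiftedFactorial (3/2) ((k : ℤ) + 2*q) = B
  generalize shiftedFactorial (-(1/2)) ((k : ℤ) - 2*q) = C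
  field_simp
  ring

/-- The Wilf–Zeilberger relation between the series at `p + 1` and at `p`. -/
theorem hyperTerm_wz {p q : ℤ} (h₁ : 0 ≤ p + q + 1) (h₂ : 0 ≤ p - q) (k : ℕ) :
    hyperTerm (p + 1) q k * (6 * k + 4 * (p + 1 : ℤ) + 3) -
        4 * (hyperTerm p q k * (6 * k + 4 * p + 3)) =
      16 * ((k + 1 : ℕ) * hyperTerm p q (k + 1)) - 16 * (k * hyperTerm p q k) := by
  have m₁ : (0 : ℝ) ≤ p + q + 1 := by exact_mod_cast h₁
  have m₂ : (0 : ℝ) ≤ p - q := by exact_mod_cast h₂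
  have hk : (0 : ℝ) ≤ k := k.cast_nonneg
  have d₁ : (k + p + q + 2 : ℝ) ≠ 0 := by linarith
  have d₂ : (k + p - q + 1 : ℝ) ≠ 0 := by linarith
  rw [hyperTerm_succ h₁ h₂, hyperTerm_add_one_left h₁ h₂]
  push_cast
  field_simp
  ring

/-- The `p`-independent majorant of `hyperTerm p q k / hyperTerm p q 0`. -/
noncomputable def hyperBound (q : ℤ) (k : ℕ) : ℝ :=
  ∏ j ∈ Finset.range k, |((3/2 + 2*q + j) * (-(1/2) - 2*q + j) : ℝ)| / (4 * ((j : ℝ) + 1) ^ 2)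

theorem hyperBound_pos (q : ℤ) (k : ℕ) : 0 < hyperBound q k := by
  refine Finset.prod_pos fun j _ => div_pos (abs_pos.mpr (mul_ne_zero ?_ ?_)) (by positivity)
  · convert three_halves_add_int_ne_zero (2 * q + j) using 1
    push_cast; ring
  · convert neg_half_add_int_ne_zero (-2 * q + j) using 1
    push_cast; ring

theorem hyperBound_succ (q : ℤ) (k : ℕ) : hyperBound q (k + 1) = hyperBound q k *
    (|((3/2 + 2*q + k) * (-(1/2) - 2*q + k) : ℝ)| / (4 * ((k : ℝ) + 1) ^ 2)) :=
  Finset.prod_range_succ _ _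

theorem abs_hyperTerm_le {p q : ℤ} (h₁ : 0 ≤ p + q + 1) (h₂ : 0 ≤ p - q) (k : ℕ) :
    |hyperTerm p q k| ≤ |hyperTerm p q 0| * hyperBound q k := by
  have m₁ : (0 : ℝ) ≤ p + q + 1 := by exact_mod_cast h₁
  have m₂ : (0 : ℝ) ≤ p - q := by exact_mod_cast h₂
  induction k with
  | zero => simp [hyperBound]
  | succ k ih =>
    have hk : (0 : ℝ) ≤ k := k.cast_nonneg
    have d₁ : (0 : ℝ) < k + p + q + 2 := by linarith
    have d₂ : (0 : ℝ) < k + p - q + 1 := by linarith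
    have key : |(-((3/2 + 2*p + k) * ((3/2 + 2*q + k) * (-(1/2) - 2*q + k))) /
        (8 * (k + 1) * ((k + p + q + 2) * (k + p - q + 1))) : ℝ)| ≤
        |((3/2 + 2*q + k) * (-(1/2) - 2*q + k) : ℝ)| / (4 * ((k : ℝ) + 1) ^ 2) := by
      have h3 : (3/2 + 2*p + k : ℝ) * (k + 1) ≤ 2 * ((k + p + q + 2) * (k + p - q + 1)) := by
        nlinarith [mul_nonneg m₁ m₂, mul_nonneg hk m₁, mul_nonneg hk m₂]
      rw [abs_div, abs_neg, abs_mul, abs_of_pos (show (0 : ℝ) < 3/2 + 2*p + k by linarith),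
        abs_of_pos (show (0 : ℝ) < 8 * (k + 1) * ((k + p + q + 2) * (k + p - q + 1)) by positivity),
        div_le_div_iff₀ (by positivity) (by positivity)]
      have h4 := mul_le_mul_of_nonneg_left h3
        (show 0 ≤ 4 * ((k : ℝ) + 1) * |((3/2 + 2*q + k) * (-(1/2) - 2*q + k) : ℝ)| by positivity)
      linarith
    rw [hyperTerm_succ h₁ h₂, abs_mul, hyperBound_succ]
    calc _ ≤ _ := mul_le_mul key ih (abs_nonneg _) (by positivity)
      _ = _ := by ring

theorem summable_hyperBound (q : ℤ) : Summable fun k : ℕ => hyperBound q k * (2 * k + 1) := by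
  refine summable_of_ratio_test_tendsto_lt_one (l := 1 / 4) (by norm_num) ?_ ?_
  · exact Eventually.of_forall fun k => (mul_pos (hyperBound_pos q k) (by positivity)).ne'
  · have hinv : Tendsto (fun k : ℕ => ((k : ℝ) + 1)⁻¹) atTop (𝓝 0) := by
      simpa using tendsto_one_div_add_atTop_nhds_zero_nat (𝕜 := ℝ)
    have hinv2 : Tendsto (fun k : ℕ => (2 * (k : ℝ) + 1)⁻¹) atTop (𝓝 0) := by
      refine squeeze_zero (fun k => by positivity) (fun k => ?_) hinv
      gcongr
      linarith [k.cast_nonneg (α := ℝ)]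
    have hlim : Tendsto (fun k : ℕ => |(1 + (1/2 + 2*q) * ((k : ℝ) + 1)⁻¹) *
        (1 + (-(3/2) - 2*q) * ((k : ℝ) + 1)⁻¹)| / 4 * (1 + 2 * (2 * (k : ℝ) + 1)⁻¹)) atTop
        (𝓝 (|((1 + (1/2 + 2*q) * 0) * (1 + (-(3/2) - 2*q) * 0) : ℝ)| / 4 * (1 + 2 * 0 : ℝ))) :=
      ((((hinv.const_mul _).const_add _).mul ((hinv.const_mul _).const_add _)).abs.div_const _).mul
        ((hinv2.const_mul _).const_add _)
    convert hlim using 1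
    · funext k
      have hk : (0 : ℝ) < k + 1 := by positivity
      have e : (1 + (1/2 + 2*q) * ((k : ℝ) + 1)⁻¹) * (1 + (-(3/2) - 2*q) * ((k : ℝ) + 1)⁻¹) =
          ((3/2 + 2*q + k) * (-(1/2) - 2*q + k)) / ((k : ℝ) + 1) ^ 2 := by
        field_simp
        ring
      have hb := hyperBound_pos q k
      rw [e, hyperBound_succ, abs_div, abs_of_pos (show (0 : ℝ) < (k + 1) ^ 2 by positivity),
        norm_mul, norm_mul, norm_mul, Real.norm_of_nonneg hb.le,
        Real.norm_of_nonneg (show (0 : ℝ) ≤ 2 * k + 1 by positivity),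
        Real.norm_of_nonneg (show (0 : ℝ) ≤ 2 * ((k + 1 : ℕ) : ℝ) + 1 by positivity),
        Real.norm_of_nonneg (by positivity)]
      push_cast
      field_simp
      ring
    · norm_num

/-- The summand of the series, normalised by `4 ^ p`. -/
noncomputable def normTerm (p q : ℤ) (k : ℕ) : ℝ :=
  hyperTerm p q k * (6 * k + 4 * p + 3) / 4 ^ p

theorem abs_normTerm_le {p q : ℤ} (h₁ : 0 ≤ p + q + 1) (h₂ : 0 ≤ p - q) (k : ℕ) :
    |normTerm p q k| ≤ |normTerm p q 0| * (hyperBound q k * (2 * k + 1)) := by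
  have m₁ : (0 : ℝ) ≤ p := by exact_mod_cast (show 0 ≤ p by omega)
  have hk : (0 : ℝ) ≤ k := k.cast_nonneg
  have h4 : (0 : ℝ) < 4 ^ p := by positivity
  unfold normTerm
  rw [abs_div, abs_div, abs_mul, abs_mul, abs_of_pos h4,
    abs_of_pos (show (0 : ℝ) < 6 * k + 4 * p + 3 by positivity),
    abs_of_pos (show (0 : ℝ) < 6 * (0 : ℕ) + 4 * p + 3 by simp; positivity), div_mul_eq_mul_div]
  refine div_le_div_of_nonneg_right ?_ h4.le
  have h5 : (6 * k + 4 * p + 3 : ℝ) ≤ (6 * (0 : ℕ) + 4 * p + 3) * (2 * k + 1) := by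
    push_cast
    nlinarith [mul_nonneg m₁ hk]
  calc _ ≤ _ := mul_le_mul (abs_hyperTerm_le h₁ h₂ k) h5 (by positivity)
        (mul_nonneg (abs_nonneg _) (hyperBound_pos q k).le)
    _ = _ := by ring

theorem summable_normTerm {p q : ℤ} (h₁ : 0 ≤ p + q + 1) (h₂ : 0 ≤ p - q) :
    Summable (normTerm p q) :=
  .of_norm_bounded ((summable_hyperBound q).mul_left _) (abs_normTerm_le h₁ h₂)

theorem tsum_normTerm_add_one {p q : ℤ} (h₁ : 0 ≤ p + q + 1) (h₂ : 0 ≤ p - q) :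
    ∑' k, normTerm (p + 1) q k = ∑' k, normTerm p q k := by
  have s₀ := summable_normTerm h₁ h₂
  have s₁ := summable_normTerm (p := p + 1) (q := q) (by omega) (by omega)
  have m₁ : (0 : ℝ) ≤ p := by exact_mod_cast (show 0 ≤ p by omega)
  have h4 : (0 : ℝ) < 4 ^ p := by positivity
  set G : ℕ → ℝ := fun k => 4 * (k * hyperTerm p q k) / 4 ^ p with hG
  have hstep (k : ℕ) : normTerm (p + 1) q k - normTerm p q k = G (k + 1) - G k := by
    have := hyperTerm_wz h₁ h₂ k
    simp only [normTerm, hG]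
    rw [zpow_add_one₀ (by norm_num)]
    field_simp
    linarith
  have hG0 : Tendsto G atTop (𝓝 0) := by
    refine squeeze_zero_norm (fun k => ?_) (by simpa using s₀.tendsto_atTop_zero.norm)
    have hk : (0 : ℝ) ≤ k := k.cast_nonneg
    simp only [normTerm, hG, Real.norm_eq_abs, abs_div, abs_mul, abs_of_pos h4, Nat.abs_cast,
      abs_of_pos (show (0 : ℝ) < 4 by norm_num),
      abs_of_pos (show (0 : ℝ) < 6 * k + 4 * p + 3 by positivity)]
    refine div_le_div_of_nonneg_right ?_ h4.le
    nlinarith [mul_nonneg (abs_nonneg (hyperTerm p q k)) hk,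
      mul_nonneg (abs_nonneg (hyperTerm p q k)) m₁, abs_nonneg (hyperTerm p q k)]
  have hsum := (s₁.sub s₀).hasSum.tendsto_sum_nat
  simp only [hstep, Finset.sum_range_sub] at hsum
  have h0 : G 0 = 0 := by simp [hG]
  have := tendsto_nhds_unique hsum (hG0.sub_const (G 0))
  simp only [← hstep, h0, sub_zero] at this
  rw [s₁.tsum_sub s₀] at this
  linarith

theorem tsum_normTerm_add_nat {p q : ℤ} (h₁ : 0 ≤ p + q + 1) (h₂ : 0 ≤ p - q) (n : ℕ) :
    ∑' k, normTerm (p + n) q k = ∑' k, normTerm p q k := by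
  induction n with
  | zero => simp
  | succ n ih =>
    rw [← ih, ← tsum_normTerm_add_one (p := p + n) (by omega) (by omega)]
    push_cast
    rw [add_assoc]

theorem abs_normTerm_succ_le {p q : ℤ} (h₁ : 0 ≤ p + q + 1) (h₂ : 0 ≤ p - q) (k : ℕ) :
    |normTerm p q (k + 1)| ≤
      3 * |((3/2 + 2*q + k) * (-(1/2) - 2*q + k) : ℝ)| / (8 * (k + 1)) *
        (((p : ℝ) + (k - q + 1))⁻¹ + ((p : ℝ) + (k + q + 2))⁻¹) * |normTerm p q k| := by
  have m₁ : (0 : ℝ) ≤ p + q + 1 := by exact_mod_cast h₁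
  have m₂ : (0 : ℝ) ≤ p - q := by exact_mod_cast h₂
  have m₃ : (0 : ℝ) ≤ p := by exact_mod_cast (show 0 ≤ p by omega)
  have hk : (0 : ℝ) ≤ k := k.cast_nonneg
  have d₁ : (0 : ℝ) < k + p + q + 2 := by linarith
  have d₂ : (0 : ℝ) < k + p - q + 1 := by linarith
  have h4 : (0 : ℝ) < 4 ^ p := by positivity
  have n₁ : (0 : ℝ) < 3/2 + 2*p + k := by positivity
  have e : ((p : ℝ) + (k - q + 1))⁻¹ + ((p : ℝ) + (k + q + 2))⁻¹ =
      (2 * p + 2 * k + 3) / ((k + p + q + 2) * (k + p - q + 1)) := by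
    rw [show (p : ℝ) + (k - q + 1) = k + p - q + 1 by ring,
      show (p : ℝ) + (k + q + 2) = k + p + q + 2 by ring]
    field_simp
    ring
  rw [e]
  unfold normTerm
  rw [hyperTerm_succ h₁ h₂, neg_div, neg_mul, neg_mul, neg_div, abs_neg,
    show (3/2 + 2*p + k : ℝ) * ((3/2 + 2*q + k) * (-(1/2) - 2*q + k)) /
      (8 * (k + 1) * ((k + p + q + 2) * (k + p - q + 1))) * hyperTerm p q k *
      (6 * (k + 1 : ℕ) + 4 * p + 3) / 4 ^ p =
      ((3/2 + 2*q + k) * (-(1/2) - 2*q + k)) * (hyperTerm p q k *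
        ((3/2 + 2*p + k) * (6 * (k + 1 : ℕ) + 4 * p + 3) /
        (8 * (k + 1) * ((k + p + q + 2) * (k + p - q + 1)) * 4 ^ p))) by field_simp,
    abs_mul, abs_mul (hyperTerm p q k), abs_div (hyperTerm p q k * _), abs_mul (hyperTerm p q k),
    abs_of_pos h4, abs_of_pos (show (0 : ℝ) < 6 * k + 4 * p + 3 by positivity),
    abs_of_pos (show (0 : ℝ) < (3/2 + 2*p + k) * (6 * (k + 1 : ℕ) + 4 * p + 3) /
        (8 * (k + 1) * ((k + p + q + 2) * (k + p - q + 1)) * 4 ^ p) by positivity),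
    show 3 * |((3/2 + 2*q + k) * (-(1/2) - 2*q + k) : ℝ)| / (8 * (k + 1)) *
        ((2 * p + 2 * k + 3) / ((k + p + q + 2) * (k + p - q + 1))) *
        (|hyperTerm p q k| * (6 * k + 4 * p + 3) / 4 ^ p) =
      |((3/2 + 2*q + k) * (-(1/2) - 2*q + k) : ℝ)| * (|hyperTerm p q k| *
        ((2 * p + 2 * k + 3) * (3 * (6 * k + 4 * p + 3)) /
        (8 * (k + 1) * ((k + p + q + 2) * (k + p - q + 1)) * 4 ^ p))) by field_simp]
  refine mul_le_mul_of_nonneg_left (mul_le_mul_of_nonneg_left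
    (div_le_div_of_nonneg_right (mul_le_mul ?_ ?_ ?_ ?_) ?_) (abs_nonneg _)) (abs_nonneg _)
  · linarith
  · push_cast
    linarith
  all_goals positivity

theorem shiftedFactorial_mul_reflection (q : ℤ) :
    shiftedFactorial (3/2) (2 * q) * shiftedFactorial (-(1/2)) (-(2 * q)) = 1 := by
  have h₁ := Real.Gamma_mul_Gamma_one_sub (3/2 + 2 * q)
  have h₂ := Real.Gamma_mul_Gamma_one_sub (3/2)
  have hs : Real.sin (Real.pi * (3/2)) = -1 := by
    rw [show Real.pi * (3/2) = Real.pi / 2 + Real.pi by ring, Real.sin_add_pi, Real.sin_pi_div_two]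
  have hs' : Real.sin (Real.pi * (3/2 + 2 * q)) = -1 := by
    rw [← hs, show Real.pi * (3/2 + 2 * q) = Real.pi * (3/2) + q * (2 * Real.pi) by ring,
      Real.sin_add_int_mul_two_pi]
  rw [hs', show (1 : ℝ) - (3/2 + 2 * q) = -(1/2) + -(2 * q) by ring] at h₁
  rw [hs, show (1 : ℝ) - 3/2 = -(1/2) by ring] at h₂
  unfold shiftedFactorial
  push_cast
  rw [div_mul_div_comm, h₁, h₂, div_self]
  simp [Real.pi_ne_zero]

theorem normTerm_zero_right (N : ℕ) (q : ℤ) :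
    normTerm N q 0 = 16 / (Real.sqrt 2 * Real.pi) *
      (Real.Gamma (1/4 + N + 1) * Real.Gamma (3/4 + N + 1) /
        (((N : ℤ) + (q + 1)).toNat.factorial * ((N : ℤ) + -q).toNat.factorial)) := by
  have hN : (0 : ℝ) ≤ N := N.cast_nonneg
  have hG : shiftedFactorial (3/2) (2 * (N : ℤ)) * (4 * N + 3) =
      16 / (Real.sqrt 2 * Real.pi) *
        (Real.Gamma (1/4 + N + 1) * Real.Gamma (3/4 + N + 1)) * 4 ^ N := by
    have hd := Real.Gamma_mul_Gamma_add_half (1/4 + N + 1)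
    have hpow : (2 : ℝ) ^ (1 - 2 * (1/4 + N + 1) : ℝ) = (4 ^ N * (2 * Real.sqrt 2))⁻¹ := by
      rw [show (1 - 2 * (1/4 + N + 1) : ℝ) = -(2 * N + (1 + 1/2)) by ring,
        Real.rpow_neg (by norm_num), Real.rpow_add (by norm_num), Real.rpow_add (by norm_num),
        Real.rpow_mul (by norm_num), Real.rpow_natCast, ← Real.sqrt_eq_rpow]
      norm_num
    rw [show (1/4 + N + 1 + 1/2 : ℝ) = 3/4 + N + 1 by ring, hpow,
      show (2 * (1/4 + N + 1) : ℝ) = (3/2 + 2 * N) + 1 by ring,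
      Real.Gamma_add_one (s := 3/2 + 2 * N) (by positivity)] at hd
    have h32 : Real.Gamma (3/2) = 1/2 * Real.sqrt Real.pi := by
      rw [show (3/2 : ℝ) = 1/2 + 1 by norm_num, Real.Gamma_add_one (by norm_num),
        Real.Gamma_one_half_eq]
    have hpi : Real.sqrt Real.pi * Real.sqrt Real.pi = Real.pi :=
      Real.mul_self_sqrt Real.pi_pos.le
    have h2 : Real.sqrt 2 * Real.sqrt 2 = 2 := Real.mul_self_sqrt (by norm_num)
    have hpi0 : Real.sqrt Real.pi ≠ 0 := (Real.sqrt_pos.mpr Real.pi_pos).ne'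
    have h20 : Real.sqrt 2 ≠ 0 := by positivity
    rw [hd]
    unfold shiftedFactorial
    push_cast
    rw [h32]
    generalize Real.sqrt 2 = t at *
    generalize Real.sqrt Real.pi = r at *
    rw [← hpi]
    field_simp
    rw [pow_two, h2]
    ring
  have hq := shiftedFactorial_mul_reflection q
  unfold normTerm hyperTerm
  rw [show ((0 : ℕ) : ℤ) + 2 * (N : ℤ) = 2 * N by simp, show ((0 : ℕ) : ℤ) + 2 * q = 2 * q by simp,
    show ((0 : ℕ) : ℤ) - 2 * q = -(2 * q) by simp,
    show ((0 : ℕ) : ℤ) + N + q + 1 = N + (q + 1) by push_cast; ring,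
    show ((0 : ℕ) : ℤ) + N - q = N + -q by push_cast; ring, mul_assoc (shiftedFactorial _ _), hq]
  have : (4 : ℝ) ^ (N : ℤ) = 4 ^ N := zpow_natCast _ _
  rw [this, ← mul_div_assoc, eq_div_iff (by positivity), div_mul_eq_mul_div,
    div_eq_iff (by positivity), ← hG]
  push_cast
  simp only [Nat.factorial_zero, Nat.cast_one]
  field_simp
  simp

theorem Real.Gamma_add_natCast_eq_prod {s : ℝ} (hs : 0 < s) (n : ℕ) :
    Real.Gamma (s + n) = (∏ j ∈ Finset.range n, (s + j)) * Real.Gamma s := by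
  induction n with
  | zero => simp
  | succ n ih =>
    rw [Finset.prod_range_succ, Nat.cast_succ, ← add_assoc, Real.Gamma_add_one (by positivity), ih]
    ring

theorem Real.tendsto_Gamma_div_rpow_mul_factorial {s : ℝ} (hs : 0 < s) :
    Tendsto (fun n : ℕ => Real.Gamma (s + n + 1) / ((n : ℝ) ^ s * n.factorial)) atTop (𝓝 1) := by
  have hG := (Real.Gamma_pos_of_pos hs).ne'
  have h := (Real.GammaSeq_tendsto_Gamma s).inv₀ hG |>.const_mul (Real.Gamma s)
  rw [mul_inv_cancel₀ hG] at h
  refine h.congr fun n => ?_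
  have := Real.Gamma_add_natCast_eq_prod hs (n + 1)
  rw [Nat.cast_succ, ← add_assoc] at this
  rw [this, Real.GammaSeq, inv_div]
  ring

theorem tendsto_toNat_factorial_div (m : ℤ) :
    Tendsto (fun n : ℕ => (((n : ℤ) + m).toNat.factorial : ℝ) / ((n : ℝ) ^ m * n.factorial))
      atTop (𝓝 1) := by
  have hratio (m : ℤ) : Tendsto (fun n : ℕ => ((n : ℝ) + m + 1) / n) atTop (𝓝 1) := by
    have h := (tendsto_inv_atTop_nhds_zero_nat (𝕜 := ℝ)).const_mul (m + 1 : ℝ) |>.const_add 1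
    rw [mul_zero, add_zero] at h
    refine h.congr' ?_
    filter_upwards [eventually_gt_atTop 0] with n hn
    have : (0 : ℝ) < n := by exact_mod_cast hn
    field_simp
    ring
  have hstep (m : ℤ) : ∀ᶠ n : ℕ in atTop,
      (((n : ℤ) + (m + 1)).toNat.factorial : ℝ) / ((n : ℝ) ^ (m + 1) * n.factorial) =
      ((n : ℝ) + m + 1) / n * ((((n : ℤ) + m).toNat.factorial : ℝ) /
        ((n : ℝ) ^ m * n.factorial)) := by
    filter_upwards [eventually_gt_atTop m.natAbs] with n hn
    have h0 : (0 : ℝ) < n := by exact_mod_cast (show 0 < n by omega)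
    rw [← add_assoc, toNat_factorial_add_one (by omega), zpow_add_one₀ h0.ne']
    push_cast
    field_simp
  induction m using Int.induction_on with
  | zero =>
    refine tendsto_const_nhds.congr fun n => ?_
    have : (n.factorial : ℝ) ≠ 0 := by positivity
    simp [this]
  | succ m ih =>
    have h := (hratio m).mul ih
    rw [mul_one] at h
    exact h.congr' ((hstep m).mono fun n hn => hn.symm)
  | pred m ih =>
    have h := ih.div (hratio (-m - 1)) one_ne_zero
    rw [div_one] at h
    refine h.congr' ?_
    filter_upwards [hstep (-m - 1), eventually_gt_atTop (m + 1)] with n hn hm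
    have h0 : (0 : ℝ) < n := by exact_mod_cast (show 0 < n by omega)
    have h1 : (0 : ℝ) < (n : ℝ) + (-m - 1 : ℤ) + 1 := by
      have : ((m + 1 : ℕ) : ℝ) < n := by exact_mod_cast hm
      push_cast at this ⊢
      linarith
    rw [sub_add_cancel] at hn
    simp only [Pi.div_apply]
    rw [hn, mul_div_cancel_left₀ _ (by positivity)]

theorem tendsto_normTerm_zero (q : ℤ) :
    Tendsto (fun N : ℕ => normTerm N q 0) atTop (𝓝 (16 / (Real.sqrt 2 * Real.pi))) := by
  have h := (((Real.tendsto_Gamma_div_rpow_mul_factorial (s := 1/4) (by norm_num)).mul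
    (Real.tendsto_Gamma_div_rpow_mul_factorial (s := 3/4) (by norm_num))).div
    ((tendsto_toNat_factorial_div (q + 1)).mul (tendsto_toNat_factorial_div (-q)))
    (by norm_num)).const_mul (16 / (Real.sqrt 2 * Real.pi))
  simp only [mul_one, div_one] at h
  refine h.congr' ?_
  filter_upwards [eventually_gt_atTop 0] with N hN
  have h0 : (0 : ℝ) < N := by exact_mod_cast hN
  have e₁ : (N : ℝ) ^ (1/4 : ℝ) * (N : ℝ) ^ (3/4 : ℝ) = N := by
    rw [← Real.rpow_add h0]
    norm_num
  have e₂ : (N : ℝ) ^ (q + 1) * (N : ℝ) ^ (-q) = N := by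
    rw [← zpow_add₀ h0.ne']
    simp
  rw [normTerm_zero_right]
  simp only [Pi.div_apply]
  congr 1
  rw [div_mul_div_comm, div_mul_div_comm, mul_mul_mul_comm, e₁, mul_mul_mul_comm, e₂,
    div_div_div_cancel_right₀ (by positivity)]

theorem tendsto_normTerm (q : ℤ) (k : ℕ) :
    Tendsto (fun N : ℕ => normTerm N q k) atTop
      (𝓝 (if k = 0 then 16 / (Real.sqrt 2 * Real.pi) else 0)) := by
  induction k with
  | zero => simpa using tendsto_normTerm_zero q
  | succ k ih =>
    rw [if_neg k.succ_ne_zero]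
    have hinv (c : ℝ) : Tendsto (fun N : ℕ => (((N : ℤ) : ℝ) + c)⁻¹) atTop (𝓝 0) := by
      simp only [Int.cast_natCast]
      exact (tendsto_atTop_add_const_right _ c tendsto_natCast_atTop_atTop).inv_tendsto_atTop
    have h := (((hinv (k - q + 1)).add (hinv (k + q + 2))).const_mul
      (3 * |((3/2 + 2*q + k) * (-(1/2) - 2*q + k) : ℝ)| / (8 * (k + 1)))).mul ih.abs
    rw [add_zero, mul_zero, zero_mul] at h
    refine squeeze_zero_norm' ?_ h
    filter_upwards [eventually_ge_atTop (q.natAbs + 1)] with N hN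
    exact abs_normTerm_succ_le (by omega) (by omega) k

theorem tsum_normTerm {p q : ℤ} (h₁ : 0 ≤ p + q + 1) (h₂ : 0 ≤ p - q) :
    ∑' k, normTerm p q k = 16 / (Real.sqrt 2 * Real.pi) := by
  have hlim := tendsto_tsum_of_dominated_convergence (𝓕 := atTop)
    (f := fun N : ℕ => normTerm N q)
    ((summable_hyperBound q).mul_left (|16 / (Real.sqrt 2 * Real.pi)| + 1))
    (tendsto_normTerm q) (by
      filter_upwards [eventually_ge_atTop (q.natAbs + 1),
        (tendsto_normTerm_zero q).abs.eventually_le_const (lt_add_one _)] with N hN hb k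
      refine (abs_normTerm_le (by omega) (by omega) k).trans ?_
      exact mul_le_mul_of_nonneg_right hb
        (mul_nonneg (hyperBound_pos q k).le (by positivity)))
  rw [tsum_ite_eq] at hlim
  refine tendsto_nhds_unique (tendsto_const_nhds.congr' ?_) hlim
  filter_upwards [eventually_ge_atTop p.toNat] with N hN
  rw [← tsum_normTerm_add_nat h₁ h₂ (N - p.toNat)]
  congr! 3
  omega

theorem wei_gong_thm4 (p q : ℤ)
    (h : 0 ≤ min (p + q + 1) (p - q)) :
    (4 : ℝ) ^ (p + 2) / (Real.sqrt 2 * Real.pi) =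
      ∑' k : ℕ,
        (shiftedFactorial (3/2) ((k : ℤ) + 2*p) * shiftedFactorial (3/2) ((k : ℤ) + 2*q) *
          shiftedFactorial (-(1/2)) ((k : ℤ) - 2*q)) /
        ((k.factorial : ℝ) * (((k : ℤ) + p + q + 1).toNat.factorial : ℝ) *
          (((k : ℤ) + p - q).toNat.factorial : ℝ)) *
        ((6*(k : ℝ) + 4*(p : ℝ) + 3) / (-8 : ℝ) ^ k) := by
  obtain ⟨h₁, h₂⟩ := le_min_iff.mp h
  have h4 : (4 : ℝ) ^ p ≠ 0 := by positivity
  rw [zpow_add₀ (by norm_num), show (4 : ℝ) ^ (2 : ℤ) = 16 by norm_num, mul_div_assoc,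
    ← tsum_normTerm h₁ h₂, ← tsum_mul_left]
  refine tsum_congr fun k => ?_
  rw [normTerm, hyperTerm, mul_div_cancel₀ _ h4]
  ring
end
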